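/- arXiv:1408.5336 — 3 statements merged into one kernel-verified Lean document; each statement's English description precedes it below -/
import Mathlib

section
/- Let (Ω, 𝓕, ℙ) be a probability space and let D be a nonempty subset of L⁰ that is (i) directed downwards (for any g, g′ ∈ D there is h ∈ D with h ≤ g and h ≤ g′ almost surely), (ii) stable under countable concatenations (for every countable measurable partition (A_k)_{k∈ℕ} of Ω and every sequence (h_k)_{k∈ℕ} in D, the random variable Σ_{k≥1} 1_{A_k}·h_k belongs to D), and (iii) bounded below by some element of L⁰. Then for every random variable δ ∈ L⁰ with δ > 0 almost surely there exists g ∈ D such that g ≤ ess inf D + δ almost surely. -/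
open MeasureTheory Filter

/-- `I` is the (a.s. finite, real-valued) essential infimum of the family `D ⊆ L⁰`:
it is measurable, an a.s. lower bound of `D`, and dominates a.s. every other
measurable a.s. lower bound. -/
def IsEssInf {Ω : Type*} [MeasurableSpace Ω] (μ : Measure Ω)
    (D : Set (Ω → ℝ)) (I : Ω → ℝ) : Prop :=
  Measurable I ∧ (∀ Y ∈ D, ∀ᵐ ω ∂μ, I ω ≤ Y ω) ∧
    ∀ Y' : Ω → ℝ, Measurable Y' → (∀ Y ∈ D, ∀ᵐ ω ∂μ, Y' ω ≤ Y ω) →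
      ∀ᵐ ω ∂μ, Y' ω ≤ I ω

/-- A family stable under countable concatenations contains, for every sequence `h` in it and every
measurable threshold `f`, an element below `f` wherever some `h k` is below `f`. -/
theorem exists_concatenation_le {Ω : Type*} [MeasurableSpace Ω] {D : Set (Ω → ℝ)}
    (hDmeas : ∀ g ∈ D, Measurable g)
    (hconcat : ∀ (A : ℕ → Set Ω) (h : ℕ → Ω → ℝ),
      (∀ k, MeasurableSet (A k)) → Pairwise (Function.onFun Disjoint A) →
      (⋃ k, A k) = Set.univ → (∀ k, h k ∈ D) →
      (fun ω => ∑' k, (A k).indicator (h k) ω) ∈ D)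
    {f : Ω → ℝ} (hf : Measurable f) {h : ℕ → Ω → ℝ} (hh : ∀ k, h k ∈ D) :
    ∃ g ∈ D, ∀ ω, (∃ k, h k ω ≤ f ω) → g ω ≤ f ω := by
  let B : ℕ → Set Ω := fun k => {ω | h k ω ≤ f ω}
  have hB : ∀ k, MeasurableSet (B k) := fun k => measurableSet_le (hDmeas _ (hh k)) hf
  let C : ℕ → Set Ω := fun k => B k ∪ (⋃ m, B m)ᶜ
  have hC : ∀ k, MeasurableSet (C k) := fun k => (hB k).union (MeasurableSet.iUnion hB).compl
  have hU : (⋃ k, disjointed C k) = Set.univ := by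
    rw [iUnion_disjointed, ← Set.iUnion_union, Set.union_compl_self]
  refine ⟨_, hconcat (disjointed C) h (fun k => MeasurableSet.disjointed hC k)
    (disjoint_disjointed C) hU hh, ?_⟩
  rintro ω ⟨m, hm⟩
  obtain ⟨k, hk⟩ := Set.mem_iUnion.1 (hU.symm ▸ Set.mem_univ ω : ω ∈ ⋃ k, disjointed C k)
  have hsum : ∑' j, (disjointed C j).indicator (h j) ω = h k ω := by
    rw [tsum_eq_single k, Set.indicator_of_mem hk]
    intro j hj
    exact Set.indicator_of_notMem
      (fun hωj => Set.disjoint_left.1 (disjoint_disjointed C hj) hωj hk) _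
  rw [hsum]
  rcases disjointed_subset C k hk with hωB | hωB
  · exact hωB
  · exact absurd (Set.mem_iUnion.2 ⟨m, hm⟩) hωB

/-- A family stable under countable concatenations contains an element whose sublevel set below a
measurable threshold has maximal measure. -/
theorem exists_forall_measure_le_threshold {Ω : Type*} [MeasurableSpace Ω] (μ : Measure Ω)
    {D : Set (Ω → ℝ)} (hDmeas : ∀ g ∈ D, Measurable g) (hDne : D.Nonempty)
    (hconcat : ∀ (A : ℕ → Set Ω) (h : ℕ → Ω → ℝ),
      (∀ k, MeasurableSet (A k)) → Pairwise (Function.onFun Disjoint A) →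
      (⋃ k, A k) = Set.univ → (∀ k, h k ∈ D) →
      (fun ω => ∑' k, (A k).indicator (h k) ω) ∈ D)
    {f : Ω → ℝ} (hf : Measurable f) :
    ∃ g ∈ D, ∀ h ∈ D, μ {ω | h ω ≤ f ω} ≤ μ {ω | g ω ≤ f ω} := by
  let S : Set ENNReal := (fun g : Ω → ℝ => μ {ω | g ω ≤ f ω}) '' D
  obtain ⟨u, -, hu, huS⟩ := exists_seq_tendsto_sSup (hDne.image _ : S.Nonempty) (OrderTop.bddAbove S)
  choose h hh hhu using huS
  obtain ⟨g, hg, hgle⟩ := exists_concatenation_le hDmeas hconcat hf hh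
  refine ⟨g, hg, fun h' hh' => (le_sSup ⟨h', hh', rfl⟩ : _ ≤ sSup S).trans ?_⟩
  refine le_of_tendsto' hu fun k => ?_
  rw [← hhu k]
  exact measure_mono fun ω hω => hgle ω ⟨k, hω⟩

/-- If `D ⊆ L⁰` is nonempty, directed downwards, stable under countable
concatenations along measurable partitions of `Ω`, and bounded below by
an element of `L⁰`, then for every `δ ∈ L⁰₊₊` there is `g ∈ D` with
`g ≤ ess inf D + δ` a.s. -/
theorem exists_near_ess_inf_of_concatenation_stable {Ω : Type*} [MeasurableSpace Ω]
    (μ : Measure Ω) [IsProbabilityMeasure μ]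
    (D : Set (Ω → ℝ)) (hDmeas : ∀ g ∈ D, Measurable g) (hDne : D.Nonempty)
    (hdir : ∀ g ∈ D, ∀ g' ∈ D, ∃ h ∈ D,
      (∀ᵐ ω ∂μ, h ω ≤ g ω) ∧ (∀ᵐ ω ∂μ, h ω ≤ g' ω))
    (hconcat : ∀ (A : ℕ → Set Ω) (h : ℕ → Ω → ℝ),
      (∀ k, MeasurableSet (A k)) → Pairwise (Function.onFun Disjoint A) →
      (⋃ k, A k) = Set.univ → (∀ k, h k ∈ D) →
      (fun ω => ∑' k, (A k).indicator (h k) ω) ∈ D)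
    (hbdd : ∃ b : Ω → ℝ, Measurable b ∧ ∀ g ∈ D, ∀ᵐ ω ∂μ, b ω ≤ g ω)
    (I : Ω → ℝ) (hI : IsEssInf μ D I)
    (δ : Ω → ℝ) (hδmeas : Measurable δ) (hδpos : ∀ᵐ ω ∂μ, 0 < δ ω) :
    ∃ g ∈ D, ∀ᵐ ω ∂μ, g ω ≤ I ω + δ ω := by
  obtain ⟨hImeas, hIle, hImax⟩ := hI
  have hf : Measurable (fun ω => I ω + δ ω) := hImeas.add hδmeas
  obtain ⟨g, hg, hgmax⟩ := exists_forall_measure_le_threshold μ hDmeas hDne hconcat hf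
  refine ⟨g, hg, ?_⟩
  let S : Set Ω := {ω | g ω ≤ I ω + δ ω}
  have hS : MeasurableSet S := measurableSet_le (hDmeas g hg) hf
  have key : ∀ Y ∈ D, ∀ᵐ ω ∂μ, I ω + Sᶜ.indicator δ ω ≤ Y ω := by
    intro Y hY
    obtain ⟨g', hg', hg'le⟩ := exists_concatenation_le hDmeas hconcat hf
      (h := fun k => if k = 0 then g else Y) (fun k => by split_ifs <;> assumption)
    have hsub : S ⊆ {ω | g' ω ≤ I ω + δ ω} := 
      fun ω (hω : g ω ≤ I ω + δ ω) => hg'le ω ⟨0, by simpa using hω⟩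
    have hae : S =ᵐ[μ] {ω | g' ω ≤ I ω + δ ω} :=
      ae_eq_of_subset_of_measure_ge hsub (hgmax g' hg') hS.nullMeasurableSet (measure_ne_top _ _)
    filter_upwards [hae.mem_iff, hIle Y hY] with ω hω hIY
    by_cases hωS : ω ∈ S
    · simpa [hωS] using hIY
    · rw [Set.indicator_of_mem (Set.mem_compl hωS)]
      by_contra! hlt
      exact hωS (hω.2 (hg'le ω ⟨1, by simpa using hlt.le⟩))
  filter_upwards [hImax _ (hImeas.add (hδmeas.indicator hS.compl)) key, hδpos] with ω hω hδ
  by_contra hωS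
  have hmem : ω ∈ Sᶜ := hωS
  rw [Pi.add_apply, Set.indicator_of_mem hmem] at hω
  linarith
end

section
/- Let 0 < λ < 1, δ > 0 and m be real numbers, and let (a_n)_{n≥0} be a sequence of real numbers with a₀ = 0, a₁ ≥ m, and (1 + λ)·a_n ≤ λ·a_{n−1} + a_{n+1} + δ(1 + λ)·(λ/2)ⁿ for all n ≥ 1. Then for all n ≥ 1 one has λ^{−(n−1)}·(a_n − a_{n−1}) ≥ m − δ(1 + λ). Consequently, if moreover a_n converges to a real number a, then a − a_{n−1} ≥ (λ^{n−1}/(1 − λ))·(m − δ(1 + λ)) for all n ≥ 1. -/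
open Filter

/-- A sequence satisfying `x_{k+1} ≥ r x_k - c (r/2)^{k+1}` stays above a geometric sequence, with
the errors `c / 2 ^ k` summing to `c (1 - 2^{-k})`. -/
theorem pow_mul_le_of_perturbed_recursion {r c m : ℝ} (hr : 0 ≤ r) {x : ℕ → ℝ} (h0 : m ≤ x 0)
    (hx : ∀ k, r * x k - c * (r / 2) ^ (k + 1) ≤ x (k + 1)) (k : ℕ) :
    r ^ k * (m - c * (1 - (1 / 2) ^ k)) ≤ x k := by
  induction k with
  | zero => simpa using h0
  | succ k ih =>
    calc r ^ (k + 1) * (m - c * (1 - (1 / 2) ^ (k + 1)))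
        = r * (r ^ k * (m - c * (1 - (1 / 2) ^ k))) - c * (r / 2) ^ (k + 1) := by
          rw [div_eq_mul_one_div r 2, mul_pow]
          ring
      _ ≤ r * x k - c * (r / 2) ^ (k + 1) := by gcongr
      _ ≤ x (k + 1) := hx k

/-- If the increments of a convergent sequence dominate a geometric sequence, then the distance
to the limit dominates the corresponding geometric tail. -/
theorem geometric_tail_le_of_tendsto {r M l : ℝ} (hr0 : 0 ≤ r) (hr1 : r < 1) {a : ℕ → ℝ}
    (ha : ∀ k, r ^ k * M ≤ a (k + 1) - a k) (hl : Tendsto a atTop (nhds l)) (k : ℕ) :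
    r ^ k / (1 - r) * M ≤ l - a k := by
  have hr : 1 - r ≠ 0 := (sub_pos.mpr hr1).ne'
  have hmono : Monotone fun n ↦ a n + r ^ n / (1 - r) * M := by
    refine monotone_nat_of_le_succ fun n ↦ ?_
    have hstep : r ^ n / (1 - r) * M - r ^ (n + 1) / (1 - r) * M = r ^ n * M := by
      field_simp
      ring
    linarith [ha n]
  have hlim : Tendsto (fun n ↦ a n + r ^ n / (1 - r) * M) atTop (nhds l) := by
    simpa using hl.add
      (((tendsto_pow_atTop_nhds_zero_of_lt_one hr0 hr1).div_const (1 - r)).mul_const M)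
  linarith [hmono.ge_of_tendsto hlim k]

/-- The telescoping estimate: if `a₀ = 0`, `a₁ ≥ m` and
`(1 + λ)aₙ ≤ λa_{n−1} + a_{n+1} + δ(1 + λ)(λ/2)ⁿ` for all `n ≥ 1`, then
`λ^{−(n−1)}(aₙ − a_{n−1}) ≥ m − δ(1 + λ)` for all `n ≥ 1`; consequently, if
`aₙ → a`, then `a − a_{n−1} ≥ (λ^{n−1}/(1 − λ))(m − δ(1 + λ))` for all `n ≥ 1`. -/
theorem telescoping_estimate (lam δ m : ℝ) (hlam0 : 0 < lam) (hlam1 : lam < 1)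
    (hδ : 0 < δ) (a : ℕ → ℝ) (ha0 : a 0 = 0) (ha1 : m ≤ a 1)
    (hrec : ∀ n, 1 ≤ n →
      (1 + lam) * a n ≤ lam * a (n - 1) + a (n + 1) + δ * (1 + lam) * (lam / 2) ^ n) :
    (∀ n : ℕ, 1 ≤ n → m - δ * (1 + lam) ≤ lam ^ (-((n : ℤ) - 1)) * (a n - a (n - 1))) ∧
      (∀ l : ℝ, Tendsto a atTop (nhds l) →
        ∀ n : ℕ, 1 ≤ n → lam ^ (n - 1) / (1 - lam) * (m - δ * (1 + lam)) ≤ l - a (n - 1)) := by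
  have hincr (k : ℕ) : lam ^ k * (m - δ * (1 + lam)) ≤ a (k + 1) - a k := by
    refine le_trans ?_ (pow_mul_le_of_perturbed_recursion (c := δ * (1 + lam)) (m := m)
      (x := fun k ↦ a (k + 1) - a k) hlam0.le (by simpa [ha0] using ha1) (fun k ↦ ?_) k)
    · have hpow : (0 : ℝ) ≤ (1 / 2) ^ k := by positivity
      refine mul_le_mul_of_nonneg_left (sub_le_sub_left ?_ m) (pow_nonneg hlam0.le k)
      exact mul_le_of_le_one_right (by positivity) (sub_le_self 1 hpow)
    · have h := hrec (k + 1) k.succ_pos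
      rw [Nat.add_sub_cancel] at h
      linarith
  refine ⟨fun n hn ↦ ?_, fun l hl n _ ↦ geometric_tail_le_of_tendsto hlam0.le hlam1 hincr hl _⟩
  obtain ⟨k, rfl⟩ := Nat.exists_eq_add_of_le' hn
  have hexp : -(((k + 1 : ℕ) : ℤ) - 1) = -(k : ℤ) := by simp
  rw [hexp, zpow_neg, zpow_natCast, Nat.add_sub_cancel, le_inv_mul_iff₀ (pow_pos hlam0 k)]
  exact hincr k
end

section
/- (Classical Simons' inequality.) Let E be a nonempty set, M > 0 a real number, and (f_n)_{n∈ℕ} a sequence of functions f_n : E → ℝ with |f_n(x)| ≤ M for all n and all x ∈ E. Let S be a subset of E such that for every sequence (λ_n)_{n∈ℕ} of strictly positive real numbers with Σ_{n≥1} λ_n = 1 there exists z ∈ S with Σ_{n≥1} λ_n·f_n(z) = sup_{x∈E} Σ_{n≥1} λ_n·f_n(x). Then sup_{x∈S} limsup_{n→∞} f_n(x) ≥ inf { sup_{x∈E} f(x) : f ∈ co{f_n : n ∈ ℕ} }, where co{f_n : n ∈ ℕ} denotes the set of all finite convex combinations Σ_{i∈I} λ_i·f_{n_i} (I finite, λ_i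 ≥ 0, Σ_{i∈I} λ_i = 1) of the functions f_n. -/
open Filter

namespace Simons

/-- Weights of total mass one, vanishing below `n` and strictly positive from `n` on. -/
structure IsTailWeight (n : ℕ) (μ : ℕ → ℝ) : Prop where
  eq_zero : ∀ i < n, μ i = 0
  pos : ∀ i, n ≤ i → 0 < μ i
  hasSum : HasSum μ 1

/-- The weighted series of the functions `f i`. -/
noncomputable def series {E : Type*} (f : ℕ → E → ℝ) (μ : ℕ → ℝ) (x : E) : ℝ :=
  ∑' i, μ i * f i x

theorem IsTailWeight.nonneg {n : ℕ} {μ : ℕ → ℝ} (h : IsTailWeight n μ) (i : ℕ) : 0 ≤ μ i := by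
  rcases lt_or_ge i n with hi | hi
  · exact (h.eq_zero i hi).ge
  · exact (h.pos i hi).le

theorem exists_isTailWeight (n : ℕ) : ∃ μ, IsTailWeight n μ := by
  refine ⟨fun i => if i < n then 0 else 1 / 2 / 2 ^ (i - n), fun i hi => by simp [hi],
    fun i hi => ?_, ?_⟩
  · simp only [not_lt.mpr hi, if_false]
    positivity
  · rw [← hasSum_nat_add_iff' n]
    have h0 : ∑ i ∈ Finset.range n, (if i < n then (0 : ℝ) else 1 / 2 / 2 ^ (i - n)) = 0 :=
      Finset.sum_eq_zero fun i hi => by simp [Finset.mem_range.mp hi]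
    rw [h0, sub_zero]
    simpa using hasSum_geometric_two' (1 : ℝ)

section Series

variable {E : Type*} {M : ℝ} {f : ℕ → E → ℝ}

theorem summable_mul (hf : ∀ n x, |f n x| ≤ M) {μ : ℕ → ℝ} (hμ : Summable μ) (x : E) :
    Summable fun i => μ i * f i x := by
  refine Summable.of_norm_bounded (hμ.abs.mul_right M) fun i => ?_
  rw [Real.norm_eq_abs, abs_mul]
  exact mul_le_mul_of_nonneg_left (hf i x) (abs_nonneg _)

theorem abs_series_le (hf : ∀ n x, |f n x| ≤ M) {μ : ℕ → ℝ} (hμ : Summable μ) (x : E) :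
    |series f μ x| ≤ (∑' i, |μ i|) * M := by
  rw [← Real.norm_eq_abs, ← tsum_mul_right]
  refine tsum_of_norm_bounded (hμ.abs.mul_right M).hasSum fun i => ?_
  rw [Real.norm_eq_abs, abs_mul]
  exact mul_le_mul_of_nonneg_left (hf i x) (abs_nonneg _)

theorem bddAbove_range_series (hf : ∀ n x, |f n x| ≤ M) {μ : ℕ → ℝ} (hμ : Summable μ) :
    BddAbove (Set.range (series f μ)) :=
  ⟨_, Set.forall_mem_range.mpr fun x => (abs_le.mp (abs_series_le hf hμ x)).2⟩

theorem series_le_iSup (hf : ∀ n x, |f n x| ≤ M) {μ : ℕ → ℝ} (hμ : Summable μ) (x : E) :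
    series f μ x ≤ ⨆ y, series f μ y :=
  le_ciSup (bddAbove_range_series hf hμ) x

theorem series_add_smul (hf : ∀ n x, |f n x| ≤ M) {μ ν : ℕ → ℝ} (hμ : Summable μ)
    (hν : Summable ν) (c : ℝ) (x : E) :
    series f (μ + c • ν) x = series f μ x + c * series f ν x := by
  unfold series
  rw [← tsum_mul_left, ← (summable_mul hf hμ x).tsum_add ((summable_mul hf hν x).mul_left c)]
  exact tsum_congr fun i => by simp only [Pi.add_apply, Pi.smul_apply, smul_eq_mul]; ring

theorem IsTailWeight.series_le (hf : ∀ n x, |f n x| ≤ M) {n : ℕ} {μ : ℕ → ℝ}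
    (hμ : IsTailWeight n μ) {x : E} {c : ℝ} (hc : ∀ i, n ≤ i → f i x ≤ c) :
    series f μ x ≤ c := by
  refine hasSum_le (fun i => ?_) (summable_mul hf hμ.hasSum.summable x).hasSum
    (by simpa using hμ.hasSum.mul_right c)
  rcases lt_or_ge i n with hi | hi
  · simp [hμ.eq_zero i hi]
  · exact mul_le_mul_of_nonneg_left (hc i hi) (hμ.nonneg i)

/-- Near-minimisers of `μ ↦ sup (series f (H + c • μ))` among tail weights. -/
theorem exists_isTailWeight_almost_min [Nonempty E] (hf : ∀ n x, |f n x| ≤ M) (n : ℕ)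
    {H : ℕ → ℝ} (hH : Summable H) (c : ℝ) {ε : ℝ} (hε : 0 < ε) :
    ∃ w, IsTailWeight n w ∧ ∀ μ, IsTailWeight n μ →
      ⨆ x, series f (H + c • w) x ≤ (⨆ x, series f (H + c • μ) x) + ε := by
  let T : Set ℝ := {y | ∃ μ, IsTailWeight n μ ∧ y = ⨆ x, series f (H + c • μ) x}
  have hne : T.Nonempty := by
    obtain ⟨μ, hμ⟩ := exists_isTailWeight n
    exact ⟨_, μ, hμ, rfl⟩
  have hbdd : BddBelow T := by
    obtain ⟨x⟩ := ‹Nonempty E›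
    refine ⟨series f H x - |c| * M, ?_⟩
    rintro y ⟨μ, hμ, rfl⟩
    have hs := hμ.hasSum.summable
    refine le_trans ?_ (series_le_iSup (μ := H + c • μ) hf (hH.add (hs.const_smul c)) x)
    rw [series_add_smul hf hH hs]
    have h1 := abs_series_le hf hs x
    have h2 : ∑' i, |μ i| = 1 := by
      rw [← hμ.hasSum.tsum_eq]
      exact tsum_congr fun i => abs_of_nonneg (hμ.nonneg i)
    rw [h2, one_mul] at h1
    have h3 : |c * series f μ x| ≤ |c| * M := by
      rw [abs_mul]
      exact mul_le_mul_of_nonneg_left h1 (abs_nonneg c)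
    linarith [(abs_le.mp h3).1]
  obtain ⟨y, ⟨w, hw, rfl⟩, hlt⟩ := exists_lt_of_csInf_lt hne (lt_add_of_pos_right (sInf T) hε)
  refine ⟨w, hw, fun μ hμ => hlt.le.trans ?_⟩
  have := csInf_le hbdd (show _ ∈ T from ⟨μ, hμ, rfl⟩)
  linarith

end Series

/-- The suprema over `E` of the finite convex combinations of the functions `f i`. -/
abbrev convexSups {E : Type*} (f : ℕ → E → ℝ) : Set ℝ :=
  {y : ℝ | ∃ g : E → ℝ,
    (∃ (I : Finset ℕ) (lam : ℕ → ℝ), (∀ i ∈ I, 0 ≤ lam i) ∧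
      (∑ i ∈ I, lam i) = 1 ∧ g = fun x => ∑ i ∈ I, lam i * f i x) ∧
    y = ⨆ x : E, g x}

theorem bddBelow_convexSups {E : Type*} [Nonempty E] {M : ℝ} {f : ℕ → E → ℝ}
    (hf : ∀ n x, |f n x| ≤ M) : BddBelow (convexSups f) := by
  refine ⟨-M, ?_⟩
  rintro y ⟨g, ⟨I, lam, hpos, hsum, rfl⟩, rfl⟩
  have hup : ∀ x, ∑ i ∈ I, lam i * f i x ≤ M := fun x => by
    calc ∑ i ∈ I, lam i * f i x ≤ ∑ i ∈ I, lam i * M := Finset.sum_le_sum fun i hi =>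
          mul_le_mul_of_nonneg_left (abs_le.mp (hf i x)).2 (hpos i hi)
      _ = M := by rw [← Finset.sum_mul, hsum, one_mul]
  obtain ⟨x⟩ := ‹Nonempty E›
  refine le_trans ?_ (le_ciSup ⟨M, Set.forall_mem_range.mpr hup⟩ x)
  calc -M = ∑ i ∈ I, lam i * -M := by rw [← Finset.sum_mul, hsum, one_mul]
    _ ≤ ∑ i ∈ I, lam i * f i x := Finset.sum_le_sum fun i hi =>
          mul_le_mul_of_nonneg_left (abs_le.mp (hf i x)).1 (hpos i hi)

theorem sInf_convexSups_le {E : Type*} [Nonempty E] {M : ℝ} {f : ℕ → E → ℝ}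
    (hf : ∀ n x, |f n x| ≤ M) {μ : ℕ → ℝ} (hμ : IsTailWeight 0 μ) :
    sInf (convexSups f) ≤ ⨆ x, series f μ x := by
  have hs := hμ.hasSum.summable
  let s : ℕ → ℝ := fun N => ∑ i ∈ Finset.range N, μ i
  have hlim : Tendsto s atTop (nhds 1) := hμ.hasSum.tendsto_sum_nat
  have hev : ∀ᶠ N in atTop, sInf (convexSups f) * s N ≤
      (⨆ x, series f μ x) + (1 - s N) * M := by
    filter_upwards [eventually_ge_atTop 1] with N hN
    have hsN : 0 < s N := Finset.sum_pos (fun i _ => hμ.pos i i.zero_le)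
      (Finset.nonempty_range_iff.mpr (by omega))
    rw [← le_div_iff₀ hsN]
    refine (csInf_le (bddBelow_convexSups hf) ⟨_, ⟨Finset.range N, fun i => μ i / s N,
      fun i _ => div_nonneg (hμ.nonneg i) hsN.le, ?_, rfl⟩, rfl⟩).trans (ciSup_le fun x => ?_)
    · rw [← Finset.sum_div]
      exact div_self hsN.ne'
    · rw [le_div_iff₀ hsN, Finset.sum_mul]
      have h1 : ∑ i ∈ Finset.range N, μ i / s N * f i x * s N =
          ∑ i ∈ Finset.range N, μ i * f i x :=
        Finset.sum_congr rfl fun i _ => by field_simp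
      rw [h1]
      have h2 := (summable_mul hf hs x).sum_add_tsum_nat_add N
      have h3 : HasSum (fun i => μ (i + N)) (1 - s N) := (hasSum_nat_add_iff' N).mpr hμ.hasSum
      have h4 : -((1 - s N) * M) ≤ ∑' i, μ (i + N) * f (i + N) x := by
        refine hasSum_le (fun i => ?_) (h3.mul_right M).neg
          ((summable_nat_add_iff N).mpr (summable_mul hf hs x)).hasSum
        have := mul_le_mul_of_nonneg_left (abs_le.mp (hf (i + N) x)).1 (hμ.nonneg (i + N))
        linarith
      have h5 := series_le_iSup hf hs x
      unfold series at h5 ⊢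
      linarith
  simpa using le_of_tendsto_of_tendsto (hlim.const_mul (sInf (convexSups f)))
    (((hlim.const_sub 1).mul_const M).const_add (⨆ x, series f μ x)) hev

section Limit

variable {w H : ℕ → ℕ → ℝ}

theorem hasSum_partial (hw : ∀ n, IsTailWeight n (w n)) (H0 : H 0 = 0)
    (Hs : ∀ n, H (n + 1) = H n + (1 / 2 ^ (n + 1) : ℝ) • w n) (n : ℕ) :
    HasSum (H n) (1 - 1 / 2 ^ n) := by
  induction n with
  | zero =>
    rw [H0, pow_zero, div_one, sub_self]
    exact hasSum_zero
  | succ n ih =>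
    rw [Hs]
    have h : (1 : ℝ) - 1 / 2 ^ (n + 1) = 1 - 1 / 2 ^ n + (1 / 2 ^ (n + 1) : ℝ) • 1 := by
      rw [smul_eq_mul]
      field_simp
      ring
    rw [h]
    exact ih.add ((hw n).hasSum.const_smul (1 / 2 ^ (n + 1) : ℝ))

/-- The diagonal `i ↦ H (i + 1) i` is the limit of the partial sums `H n`, and its rescaled
distance to `H n` is a tail weight. -/
theorem isTailWeight_diag_sub (hw : ∀ n, IsTailWeight n (w n)) (H0 : H 0 = 0)
    (Hs : ∀ n, H (n + 1) = H n + (1 / 2 ^ (n + 1) : ℝ) • w n) (n : ℕ) :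
    IsTailWeight n ((2 ^ n : ℝ) • ((fun i => H (i + 1) i) - H n)) := by
  have happ : ∀ n i, H (n + 1) i = H n i + 1 / 2 ^ (n + 1) * w n i := fun n i => by simp [Hs n]
  have hmono : ∀ i, Monotone fun n => H n i := fun i => monotone_nat_of_le_succ fun n => by
    have := (hw n).nonneg i
    rw [happ]
    exact le_add_of_nonneg_right (by positivity)
  have hstab : ∀ i n, i + 1 ≤ n → H n i = H (i + 1) i := fun i n hn => by
    induction n, hn using Nat.le_induction with
    | base => rfl
    | succ n hn ih => rw [happ, (hw n).eq_zero i (by omega), mul_zero, add_zero, ih]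
  have hle : ∀ n i, H n i ≤ H (i + 1) i := fun n i => by
    rcases le_total n (i + 1) with h | h
    · exact hmono i h
    · exact (hstab i n h).le
  have hsum := hasSum_partial hw H0 Hs
  have hnn : ∀ n i, 0 ≤ H n i := fun n i => by
    simpa [H0] using hmono i n.zero_le
  have hpartial : ∀ N, ∑ i ∈ Finset.range N, H (i + 1) i ≤ 1 := fun N => by
    calc ∑ i ∈ Finset.range N, H (i + 1) i = ∑ i ∈ Finset.range N, H N i :=
          Finset.sum_congr rfl fun i hi => (hstab i N (Finset.mem_range.mp hi)).symm
      _ ≤ 1 - 1 / 2 ^ N := sum_le_hasSum _ (fun i _ => hnn N i) (hsum N)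
      _ ≤ 1 := sub_le_self _ (by positivity)
  have hsummable : Summable fun i => H (i + 1) i :=
    summable_of_sum_range_le (fun i => hnn _ i) hpartial
  have hone : ∑' i, H (i + 1) i = 1 := by
    refine le_antisymm (hsummable.tsum_le_of_sum_range_le hpartial) ?_
    have hlim : Tendsto (fun n : ℕ => (1 : ℝ) - 1 / 2 ^ n) atTop (nhds 1) := by
      simpa using (tendsto_pow_atTop_nhds_zero_of_lt_one (r := (2 : ℝ)⁻¹)
        (by norm_num) (by norm_num)).const_sub 1
    exact le_of_tendsto' hlim fun n => hasSum_le (hle n) (hsum n) hsummable.hasSum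
  refine ⟨fun i hi => ?_, fun i hi => ?_, ?_⟩
  · simp [hstab i n hi]
  · have h1 := hle (n + 1) i
    rw [happ] at h1
    have h2 : 0 < 1 / 2 ^ (n + 1) * w n i := mul_pos (by positivity) ((hw n).pos i hi)
    simp only [Pi.smul_apply, Pi.sub_apply, smul_eq_mul]
    exact mul_pos (by positivity) (by linarith)
  · have h := hsummable.hasSum
    rw [hone] at h
    have e : (1 : ℝ) = (2 ^ n : ℝ) • (1 - (1 - 1 / 2 ^ n)) := by
      rw [smul_eq_mul]
      field_simp
      ring
    rw [e]
    exact (h.sub (hsum n)).const_smul (2 ^ n : ℝ)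

end Limit

theorem exists_mem_forall_exists_isTailWeight {E : Type*} [Nonempty E] {M : ℝ}
    {f : ℕ → E → ℝ} (hf : ∀ n x, |f n x| ≤ M) {S : Set E}
    (hS : ∀ μ, IsTailWeight 0 μ → ∃ z ∈ S, series f μ z = ⨆ x, series f μ x)
    {δ : ℝ} (hδ : 0 < δ) :
    ∃ z ∈ S, ∀ n, ∃ μ, IsTailWeight n μ ∧ sInf (convexSups f) - δ ≤ series f μ z := by
  have hex : ∀ (n : ℕ) (H : ℕ → ℝ), ∃ w, IsTailWeight n w ∧ (Summable H →
      ∀ μ, IsTailWeight n μ → ⨆ x, series f (H + (1 / 2 ^ n : ℝ) • w) x ≤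
        (⨆ x, series f (H + (1 / 2 ^ n : ℝ) • μ) x) + δ / (2 ^ n * 2 ^ (n + 1))) := by
    intro n H
    by_cases hH : Summable H
    · obtain ⟨w, hw, hmin⟩ := exists_isTailWeight_almost_min hf n hH (1 / 2 ^ n)
        (show 0 < δ / (2 ^ n * 2 ^ (n + 1)) by positivity)
      exact ⟨w, hw, fun _ => hmin⟩
    · obtain ⟨w, hw⟩ := exists_isTailWeight n
      exact ⟨w, hw, fun h => absurd h hH⟩
  choose G hG hmin using hex
  let H : ℕ → ℕ → ℝ := fun n =>
    Nat.rec (0 : ℕ → ℝ) (fun n K => K + (1 / 2 ^ (n + 1) : ℝ) • G n K) n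
  have H0 : H 0 = 0 := rfl
  have Hs : ∀ n, H (n + 1) = H n + (1 / 2 ^ (n + 1) : ℝ) • G n (H n) := fun n => rfl
  have hsum : ∀ n, Summable (H n) := fun n =>
    (hasSum_partial (fun n => hG n (H n)) H0 Hs n).summable
  have htail := isTailWeight_diag_sub (fun n => hG n (H n)) H0 Hs
  set h : ℕ → ℝ := fun i => H (i + 1) i
  have hh : IsTailWeight 0 h := by simpa [H0] using htail 0
  have hdecomp : ∀ n, H n + (1 / 2 ^ n : ℝ) • ((2 ^ n : ℝ) • (h - H n)) = h := fun n => by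
    rw [smul_smul, one_div_mul_cancel (by positivity), one_smul, add_sub_cancel]
  obtain ⟨z, hz, hzmax⟩ := hS h hh
  have key : ∀ n : ℕ, sInf (convexSups f) - δ * (1 - 1 / 2 ^ n) ≤
      2 ^ n * ((⨆ x, series f h x) - series f (H n) z) := by
    intro n
    induction n with
    | zero =>
      have h1 : series f (H 0) z = 0 := by simp [series, H0]
      simpa [h1] using sInf_convexSups_le hf hh
    | succ n ih =>
      have hGs := (hG n (H n)).hasSum.summable
      have h1 := hmin n (H n) (hsum n) _ (htail n)
      rw [hdecomp] at h1
      have h2 := series_le_iSup (μ := H n + (1 / 2 ^ n : ℝ) • G n (H n)) hf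
        ((hsum n).add (hGs.const_smul (1 / 2 ^ n : ℝ))) z
      have h3 := h2.trans h1
      rw [series_add_smul hf (hsum n) hGs] at h3
      rw [Hs, series_add_smul hf (hsum n) hGs]
      have h4 := mul_le_mul_of_nonneg_left h3 (show (0 : ℝ) ≤ 2 ^ n by positivity)
      have e1 : (2 : ℝ) ^ n * (1 / 2 ^ n * series f (G n (H n)) z) = series f (G n (H n)) z := by
        field_simp
      have e2 : ∀ p a b : ℝ, (2 : ℝ) ^ (n + 1) * (p - (a + 1 / 2 ^ (n + 1) * b)) =
          2 * (2 ^ n * p) - 2 * (2 ^ n * a) - b := fun p a b => by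
        field_simp
        ring
      have e3 : (2 : ℝ) ^ n * (δ / (2 ^ n * 2 ^ (n + 1))) = δ * (1 / 2 ^ (n + 1)) := by
        field_simp
      have e4 : δ * (1 / 2 ^ n) = 2 * (δ * (1 / 2 ^ (n + 1))) := by
        field_simp
        ring
      rw [mul_add, mul_add, e1, e3] at h4
      rw [e2]
      rw [mul_sub, mul_sub, e4] at ih
      linarith
  refine ⟨z, hz, fun n => ⟨_, htail n, ?_⟩⟩
  have h1 := series_add_smul hf (hsum n) (htail n).hasSum.summable (1 / 2 ^ n) z
  rw [hdecomp, hzmax] at h1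
  have h2 := key n
  rw [h1, add_sub_cancel_left, ← mul_assoc, mul_one_div_cancel (by positivity), one_mul] at h2
  have h3 : 0 ≤ δ * (1 / 2 ^ n) := by positivity
  linarith

end Simons

open Simons

/-- Classical Simons' inequality: if every strictly positive convex series of the
uniformly bounded functions `fₙ` attains its supremum over `E` at a point of `S`,
then `sup_{x∈S} limsup fₙ(x) ≥ inf { sup_E f : f ∈ co{fₙ} }`. -/
theorem simons_inequality {E : Type*} [Nonempty E] (M : ℝ) (hM : 0 < M)
    (f : ℕ → E → ℝ) (hf : ∀ n x, |f n x| ≤ M) (S : Set E)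
    (hS : ∀ lam : ℕ → ℝ, (∀ n, 0 < lam n) → (∑' n, lam n) = 1 →
      ∃ z ∈ S, (∑' n, lam n * f n z) = ⨆ x : E, ∑' n, lam n * f n x) :
    sInf {y : ℝ | ∃ g : E → ℝ,
        (∃ (I : Finset ℕ) (lam : ℕ → ℝ), (∀ i ∈ I, 0 ≤ lam i) ∧
          (∑ i ∈ I, lam i) = 1 ∧ g = fun x => ∑ i ∈ I, lam i * f i x) ∧
        y = ⨆ x : E, g x} ≤
      sSup {y : ℝ | ∃ x ∈ S, y = limsup (fun n => f n x) atTop} := by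
  refine le_of_forall_pos_sub_le fun δ hδ => ?_
  obtain ⟨z, hz, htail⟩ := exists_mem_forall_exists_isTailWeight hf (S := S)
    (fun μ hμ => hS μ (fun n => hμ.pos n n.zero_le) hμ.hasSum.tsum_eq) hδ
  have hbdd : ∀ x, IsBoundedUnder (· ≤ ·) atTop fun n => f n x := fun x =>
    isBoundedUnder_of ⟨M, fun n => (abs_le.mp (hf n x)).2⟩
  have hcobdd : ∀ x, IsCoboundedUnder (· ≤ ·) atTop fun n => f n x := fun x =>
    (isBoundedUnder_of ⟨-M, fun n => (abs_le.mp (hf n x)).1⟩ :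
      IsBoundedUnder (· ≥ ·) atTop fun n => f n x).isCoboundedUnder_le
  have hlimsup : sInf (convexSups f) - δ ≤ limsup (fun n => f n z) atTop := by
    by_contra! hlt
    obtain ⟨c, hc1, hc2⟩ := exists_between hlt
    obtain ⟨N, hN⟩ := eventually_atTop.mp (eventually_lt_of_limsup_lt hc1 (hbdd z))
    obtain ⟨μ, hμ, hle⟩ := htail N
    linarith [hμ.series_le hf fun i hi => (hN i hi).le]
  refine hlimsup.trans (le_csSup ⟨M, ?_⟩ ⟨z, hz, rfl⟩)
  rintro y ⟨x, -, rfl⟩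
  exact limsup_le_of_le (hcobdd x) (Eventually.of_forall fun n => (abs_le.mp (hf n x)).2)
end
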